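/- arXiv:1512.06695 — 5 statements merged into one kernel-verified Lean document; each statement's English description precedes it below -/
import Mathlib

section
/- Let Ω ⊂ ℝⁿ be a bounded open set, μ ∈ C¹(Ω;ℝ) bounded, and K ≥ 0. Let ζ = α₁ + iα₂ ∈ ℂⁿ with α₁, α₂ ∈ ℝⁿ, α₁·α₂ = 0, |α₁| = |α₂| = |ζ|/√2, and |ζ| ≥ 1. Let ψ₁, ψ₂ ∈ C¹(Ω;ℂ) satisfy sup_Ω(|ψ_j(x)| + |∇ψ_j(x)|) ≤ K/|ζ| for j = 1, 2. Define H₁(x) := μ(x)e^{iζ·x}(1+ψ₁(x)), H₂(x) := μ(x)e^{i ζ̄ ·x}(1+ψ₂(x)) (where ζ̄ = α₁ − iα₂), and β := H₁∇H₂ − H₂∇H₁. Then for every x ∈ Ω, |β(x) − 2μ(x)² e^{2iα₁·x} α₂| ≤ 5(K + K²) μ(x)². -/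
open scoped BigOperators

/-- Partial derivative (in direction `i`) of a complex-valued function on `ℝⁿ`. -/
noncomputable def pdC {n : ℕ} (f : (Fin n → ℝ) → ℂ) (i : Fin n) (x : Fin n → ℝ) : ℂ :=
  fderiv ℝ f x (Pi.single i 1)

/-- The internal data `H(x) = μ(x) e^{iζ·x} (1 + ψ(x))`. -/
noncomputable def cgoData {n : ℕ} (μ : (Fin n → ℝ) → ℝ) (ζ : Fin n → ℂ)
    (ψ : (Fin n → ℝ) → ℂ) (x : Fin n → ℝ) : ℂ :=
  (μ x : ℂ) * Complex.exp (Complex.I * ∑ i, ζ i * (x i : ℂ)) * (1 + ψ x)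

lemma pdC_cgo {n : ℕ} (μ : (Fin n → ℝ) → ℝ) (ζ : Fin n → ℂ) (ψ : (Fin n → ℝ) → ℂ)
    (x : Fin n → ℝ) (hμ : DifferentiableAt ℝ μ x) (hψ : DifferentiableAt ℝ ψ x) (i : Fin n) :
    pdC (cgoData μ ζ ψ) i x =
      Complex.exp (Complex.I * ∑ i, ζ i * (x i : ℂ)) *
        ((fderiv ℝ μ x (Pi.single i 1) : ℂ) * (1 + ψ x)
          + (μ x : ℂ) * (Complex.I * ζ i) * (1 + ψ x) + (μ x : ℂ) * pdC ψ i x) := by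
  have h1 : HasFDerivAt (fun y => (μ y : ℂ)) (Complex.ofRealCLM.comp (fderiv ℝ μ x)) x :=
    Complex.ofRealCLM.hasFDerivAt.comp x hμ.hasFDerivAt
  let L : (Fin n → ℝ) →L[ℝ] ℂ := ∑ j, ζ j • (Complex.ofRealCLM.comp (ContinuousLinearMap.proj j))
  have hL : ∀ y : Fin n → ℝ, L y = ∑ j, ζ j * (y j : ℂ) := by
    intro y; simp [L]
  have h2 : HasFDerivAt (fun y : Fin n → ℝ => ∑ j, ζ j * (y j : ℂ)) L x := by
    have := L.hasFDerivAt (x := x)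
    rwa [show (L : (Fin n → ℝ) → ℂ) = _ from funext hL] at this
  have h3 := (h2.const_mul Complex.I).cexp
  have h4 := (h1.mul h3).mul (hψ.hasFDerivAt.const_add 1)
  have h5 : HasFDerivAt (cgoData μ ζ ψ) _ x := h4
  have h6 : L (Pi.single i 1) = ζ i := by
    rw [hL, Finset.sum_eq_single i] <;> simp +contextual
  unfold pdC
  rw [h5.fderiv]
  simp [h6]
  ring

lemma sqrt_eq_norm {n : ℕ} (f : Fin n → ℂ) :
    Real.sqrt (∑ i, ‖f i‖ ^ 2) = ‖(WithLp.toLp 2 f : EuclideanSpace ℂ (Fin n))‖ := by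
  rw [EuclideanSpace.norm_eq]

/-- Asymptotics of the vector field `β = H₁∇H₂ − H₂∇H₁` built from the internal data of two
CGO solutions with phases `ζ = α₁ + iα₂` and `ζ̄ = α₁ − iα₂`:
`|β(x) − 2μ(x)² e^{2iα₁·x} α₂| ≤ 5(K + K²) μ(x)²` on `Ω`. -/
theorem beta_asymptotics {n : ℕ} (Ω : Set (Fin n → ℝ)) (hΩo : IsOpen Ω)
    (hΩb : Bornology.IsBounded Ω)
    (μ : (Fin n → ℝ) → ℝ) (hμ : ContDiffOn ℝ 1 μ Ω)
    (hμbdd : ∃ M : ℝ, ∀ x ∈ Ω, |μ x| ≤ M)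
    (K : ℝ) (hK : 0 ≤ K)
    (α₁ α₂ : Fin n → ℝ) (ζ ζb : Fin n → ℂ)
    (hζ : ∀ i, ζ i = (α₁ i : ℂ) + Complex.I * (α₂ i : ℂ))
    (hζb : ∀ i, ζb i = (α₁ i : ℂ) - Complex.I * (α₂ i : ℂ))
    (hortho : ∑ i, α₁ i * α₂ i = 0)
    (hα₁ : Real.sqrt (∑ i, α₁ i ^ 2) = Real.sqrt (∑ i, ‖ζ i‖ ^ 2) / Real.sqrt 2)
    (hα₂ : Real.sqrt (∑ i, α₂ i ^ 2) = Real.sqrt (∑ i, ‖ζ i‖ ^ 2) / Real.sqrt 2)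
    (hζbig : 1 ≤ Real.sqrt (∑ i, ‖ζ i‖ ^ 2))
    (ψ₁ ψ₂ : (Fin n → ℝ) → ℂ)
    (hψ₁ : ContDiffOn ℝ 1 ψ₁ Ω) (hψ₂ : ContDiffOn ℝ 1 ψ₂ Ω)
    (hψ₁b : ∀ x ∈ Ω,
      ‖ψ₁ x‖ + Real.sqrt (∑ i, ‖pdC ψ₁ i x‖ ^ 2) ≤ K / Real.sqrt (∑ i, ‖ζ i‖ ^ 2))
    (hψ₂b : ∀ x ∈ Ω,
      ‖ψ₂ x‖ + Real.sqrt (∑ i, ‖pdC ψ₂ i x‖ ^ 2) ≤ K / Real.sqrt (∑ i, ‖ζ i‖ ^ 2)) :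
    ∀ x ∈ Ω,
      Real.sqrt (∑ i,
        ‖(cgoData μ ζ ψ₁ x * pdC (cgoData μ ζb ψ₂) i x
            - cgoData μ ζb ψ₂ x * pdC (cgoData μ ζ ψ₁) i x)
          - 2 * (μ x : ℂ) ^ 2
              * Complex.exp (2 * Complex.I * ∑ j, (α₁ j : ℂ) * (x j : ℂ))
              * (α₂ i : ℂ)‖ ^ 2)
      ≤ 5 * (K + K ^ 2) * μ x ^ 2 := by
  intro x hx
  have hn := hΩo.mem_nhds hx
  have dμ := (hμ.contDiffAt hn).differentiableAt one_ne_zero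
  have d1 := (hψ₁.contDiffAt hn).differentiableAt one_ne_zero
  have d2 := (hψ₂.contDiffAt hn).differentiableAt one_ne_zero
  have b1 := hψ₁b x hx
  have b2 := hψ₂b x hx
  have ha : Real.sqrt (∑ i, α₂ i ^ 2) = Real.sqrt (∑ i, ‖(α₂ i : ℂ)‖ ^ 2) := by simp
  rw [ha] at hα₂
  generalize Real.sqrt (∑ i : Fin n, ‖ζ i‖ ^ 2) = Z at *
  set S : ℂ := ∑ j, (α₁ j : ℂ) * (x j : ℂ) with hS
  have hE : Complex.exp (Complex.I * ∑ i, ζ i * (x i : ℂ)) *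
      Complex.exp (Complex.I * ∑ i, ζb i * (x i : ℂ)) = Complex.exp (2 * Complex.I * S) := by
    have hs : (∑ i, ζ i * (x i : ℂ)) + ∑ i, ζb i * (x i : ℂ) = 2 * S := by
      rw [← Finset.sum_add_distrib, hS, Finset.mul_sum]
      refine Finset.sum_congr rfl fun i _ => ?_
      rw [hζ, hζb]; ring
    rw [← Complex.exp_add, ← mul_add, hs]
    congr 1
    ring
  have hEn : ‖Complex.exp (2 * Complex.I * S)‖ = 1 := by
    have : 2 * Complex.I * S = ((2 * ∑ j, α₁ j * x j : ℝ) : ℂ) * Complex.I := by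
      rw [hS]; push_cast; ring
    rw [this, Complex.norm_exp_ofReal_mul_I]
  have key : ∀ i, (cgoData μ ζ ψ₁ x * pdC (cgoData μ ζb ψ₂) i x
            - cgoData μ ζb ψ₂ x * pdC (cgoData μ ζ ψ₁) i x)
          - 2 * (μ x : ℂ) ^ 2 * Complex.exp (2 * Complex.I * S) * (α₂ i : ℂ)
      = ((μ x : ℂ) ^ 2 * Complex.exp (2 * Complex.I * S)) *
        ((2 * (ψ₁ x + ψ₂ x + ψ₁ x * ψ₂ x)) * (α₂ i : ℂ) + (1 + ψ₁ x) * pdC ψ₂ i x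
          - (1 + ψ₂ x) * pdC ψ₁ i x) := by
    intro i
    rw [pdC_cgo μ ζ ψ₁ x dμ d1, pdC_cgo μ ζb ψ₂ x dμ d2, ← hE]
    simp only [cgoData]
    rw [hζ i, hζb i]
    generalize Complex.exp (Complex.I * ∑ i : Fin n, ζ i * (x i : ℂ)) = E1
    generalize Complex.exp (Complex.I * ∑ i : Fin n, ζb i * (x i : ℂ)) = E2
    linear_combination (-2 * (μ x : ℂ) ^ 2 * E1 * E2 * (1 + ψ₁ x) * (1 + ψ₂ x) * α₂ i)
      * Complex.I_mul_I
  simp only [key]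
  rw [sqrt_eq_norm] at b1 b2 hα₂ ⊢
  set A : EuclideanSpace ℂ (Fin n) := WithLp.toLp 2 (fun i => (α₂ i : ℂ))
  set P1 : EuclideanSpace ℂ (Fin n) := WithLp.toLp 2 (fun i => pdC ψ₁ i x)
  set P2 : EuclideanSpace ℂ (Fin n) := WithLp.toLp 2 (fun i => pdC ψ₂ i x)
  have hv : (WithLp.toLp 2 (fun i => ((μ x : ℂ) ^ 2 * Complex.exp (2 * Complex.I * S)) *
        ((2 * (ψ₁ x + ψ₂ x + ψ₁ x * ψ₂ x)) * (α₂ i : ℂ) + (1 + ψ₁ x) * pdC ψ₂ i x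
          - (1 + ψ₂ x) * pdC ψ₁ i x)) : EuclideanSpace ℂ (Fin n))
      = ((μ x : ℂ) ^ 2 * Complex.exp (2 * Complex.I * S)) •
        ((2 * (ψ₁ x + ψ₂ x + ψ₁ x * ψ₂ x)) • A + (1 + ψ₁ x) • P2 - (1 + ψ₂ x) • P1) := by
    ext i; simp [A, P1, P2]
  rw [hv, norm_smul, norm_mul, hEn, mul_one, norm_pow, Complex.norm_real, Real.norm_eq_abs,
    sq_abs, mul_comm]
  refine mul_le_mul_of_nonneg_right ?_ (sq_nonneg _)
  have hZ : 0 < Z := by linarith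
  have hA : 2 * ‖A‖ ≤ 3 / 2 * Z := by
    have h2 : (4 : ℝ) / 3 ≤ Real.sqrt 2 := Real.le_sqrt_of_sq_le (by norm_num)
    rw [hα₂, ← mul_div_assoc, div_le_iff₀ (by positivity)]
    nlinarith
  have t1 : ‖(2 * (ψ₁ x + ψ₂ x + ψ₁ x * ψ₂ x)) • A‖
      ≤ (‖ψ₁ x‖ + ‖ψ₂ x‖ + ‖ψ₁ x‖ * ‖ψ₂ x‖) * (3 / 2 * Z) := by
    rw [norm_smul, norm_mul]
    have : ‖ψ₁ x + ψ₂ x + ψ₁ x * ψ₂ x‖ ≤ ‖ψ₁ x‖ + ‖ψ₂ x‖ + ‖ψ₁ x‖ * ‖ψ₂ x‖ := by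
      rw [← norm_mul]; exact norm_add₃_le
    calc _ = ‖ψ₁ x + ψ₂ x + ψ₁ x * ψ₂ x‖ * (2 * ‖A‖) := by simp; ring
      _ ≤ _ := by gcongr
  have t2 : ∀ (c : ℂ) (P : EuclideanSpace ℂ (Fin n)), ‖(1 + c) • P‖ ≤ (1 + ‖c‖) * ‖P‖ := by
    intro c P
    rw [norm_smul]
    gcongr
    simpa using norm_add_le (1 : ℂ) c
  have t3 := t2 (ψ₁ x) P2
  have t4 := t2 (ψ₂ x) P1
  have t5 := norm_sub_le ((2 * (ψ₁ x + ψ₂ x + ψ₁ x * ψ₂ x)) • A + (1 + ψ₁ x) • P2)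
    ((1 + ψ₂ x) • P1)
  have t6 := norm_add_le ((2 * (ψ₁ x + ψ₂ x + ψ₁ x * ψ₂ x)) • A) ((1 + ψ₁ x) • P2)
  refine (t5.trans (by linarith)).trans (?_ : (‖ψ₁ x‖ + ‖ψ₂ x‖ + ‖ψ₁ x‖ * ‖ψ₂ x‖) * (3 / 2 * Z)
    + (1 + ‖ψ₁ x‖) * ‖P2‖ + (1 + ‖ψ₂ x‖) * ‖P1‖ ≤ _)
  have n1 := norm_nonneg (ψ₁ x)
  have n2 := norm_nonneg (ψ₂ x)
  have n3 := norm_nonneg P1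
  have n4 := norm_nonneg P2
  have hk : K / Z * Z = K := div_mul_cancel₀ _ hZ.ne'
  have hkK : K / Z ≤ K := div_le_self hK hζbig
  have hk0 : 0 ≤ K / Z := by positivity
  generalize K / Z = k at *
  generalize ‖ψ₁ x‖ = a1 at *
  generalize ‖ψ₂ x‖ = a2 at *
  generalize ‖P1‖ = p1 at *
  generalize ‖P2‖ = p2 at *
  have u1 : a1 * Z ≤ K := by rw [← hk]; gcongr; linarith
  have u2 : a2 * Z ≤ K := by rw [← hk]; gcongr; linarith
  have u3 : a1 * (a2 * Z) ≤ K * K := mul_le_mul (by linarith) u2 (by positivity) hK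
  have u4 : a1 * p2 ≤ K * K := mul_le_mul (by linarith) (by linarith) n4 hK
  have u5 : a2 * p1 ≤ K * K := mul_le_mul (by linarith) (by linarith) n3 hK
  nlinarith [mul_nonneg hK hK]
end

section
/- Let n ≥ 2, x₀ ∈ ℝⁿ, and define φ(x) := log|x − x₀| for x ≠ x₀. Then for every x ≠ x₀: (i) ∇φ(x) ≠ 0, and (ii) for every ξ ∈ ℝⁿ with |ξ| = |∇φ(x)| and ∇φ(x)·ξ = 0, one has ⟨φ''(x)∇φ(x), ∇φ(x)⟩ + ⟨φ''(x)ξ, ξ⟩ = 0, where φ''(x) is the Hessian matrix of φ at x. That is, φ(x) = log|x − x₀| is a limiting Carleman weight on any open set avoiding x₀. -/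
open scoped BigOperators

/-- Partial derivative (in direction `i`) of a real-valued function on `ℝⁿ`. -/
noncomputable def pdR {n : ℕ} (f : (Fin n → ℝ) → ℝ) (i : Fin n) (x : Fin n → ℝ) : ℝ :=
  fderiv ℝ f x (Pi.single i 1)

lemma hasFDerivAt_Q {n : ℕ} (x₀ x : Fin n → ℝ) :
    HasFDerivAt (fun x : Fin n → ℝ => ∑ i, (x i - x₀ i) ^ 2)
      (∑ i, (2 * (x i - x₀ i)) • ContinuousLinearMap.proj (R := ℝ) (φ := fun _ : Fin n => ℝ) i) x := by
  apply HasFDerivAt.fun_sum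
  intro i _
  have h := (((hasFDerivAt_apply (𝕜 := ℝ) (F' := fun _ : Fin n => ℝ) i x).sub_const (x₀ i)).pow 2)
  have e : (2 • (x i - x₀ i) ^ (2 - 1) : ℝ) = 2 * (x i - x₀ i) := by simp
  rw [e] at h
  exact h

lemma Q_apply {n : ℕ} (d : Fin n → ℝ) (i : Fin n) :
    (∑ k, (2 * d k) • ContinuousLinearMap.proj (R := ℝ) (φ := fun _ : Fin n => ℝ) k)
      (Pi.single i 1) = 2 * d i := by
  simp [Pi.single_apply]

lemma Q_pos {n : ℕ} (x₀ x : Fin n → ℝ) (hx : x ≠ x₀) : 0 < ∑ i, (x i - x₀ i) ^ 2 := by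
  obtain ⟨i, hi⟩ := Function.ne_iff.mp hx
  exact Finset.sum_pos' (fun _ _ => sq_nonneg _) ⟨i, Finset.mem_univ _, by
    have := sub_ne_zero.mpr hi
    positivity⟩

lemma pdR_log {n : ℕ} (x₀ : Fin n → ℝ) (φ : (Fin n → ℝ) → ℝ)
    (hφ : ∀ x, φ x = Real.log (Real.sqrt (∑ i, (x i - x₀ i) ^ 2)))
    (x : Fin n → ℝ) (hx : x ≠ x₀) (i : Fin n) :
    pdR φ i x = (x i - x₀ i) * (∑ i, (x i - x₀ i) ^ 2)⁻¹ := by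
  have e : φ = fun x => (1 / 2 : ℝ) * Real.log (∑ i, (x i - x₀ i) ^ 2) := by
    funext y
    rw [hφ, Real.log_sqrt (Finset.sum_nonneg fun _ _ => sq_nonneg _)]
    ring
  have h := ((hasFDerivAt_Q x₀ x).log (Q_pos x₀ x hx).ne').const_mul (1 / 2 : ℝ)
  rw [pdR, e, h.fderiv, ContinuousLinearMap.smul_apply, ContinuousLinearMap.smul_apply,
    Q_apply (fun i => x i - x₀ i)]
  simp only [smul_eq_mul]
  ring

lemma pdR_pdR_log {n : ℕ} (x₀ : Fin n → ℝ) (φ : (Fin n → ℝ) → ℝ)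
    (hφ : ∀ x, φ x = Real.log (Real.sqrt (∑ i, (x i - x₀ i) ^ 2)))
    (x : Fin n → ℝ) (hx : x ≠ x₀) (i j : Fin n) :
    pdR (pdR φ j) i x = (if i = j then 1 else 0) * (∑ i, (x i - x₀ i) ^ 2)⁻¹
      - 2 * (x i - x₀ i) * (x j - x₀ j) * (∑ i, (x i - x₀ i) ^ 2)⁻¹ ^ 2 := by
  have e : pdR φ j =ᶠ[nhds x] fun x => (x j - x₀ j) * (∑ i, (x i - x₀ i) ^ 2)⁻¹ := by
    filter_upwards [isOpen_ne.mem_nhds hx] with y hy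
    exact pdR_log x₀ φ hφ y hy j
  have h1 := (hasFDerivAt_apply (𝕜 := ℝ) (F' := fun _ : Fin n => ℝ) j x).sub_const (x₀ j)
  have h2 := (hasDerivAt_inv (Q_pos x₀ x hx).ne').comp_hasFDerivAt x (hasFDerivAt_Q x₀ x)
  have h := h1.mul h2
  have h' : fderiv ℝ (fun x : Fin n → ℝ => (x j - x₀ j) * (∑ i, (x i - x₀ i) ^ 2)⁻¹) x = _ :=
    h.fderiv
  rw [pdR, e.fderiv_eq, h', ContinuousLinearMap.add_apply, ContinuousLinearMap.smul_apply,
    ContinuousLinearMap.smul_apply, ContinuousLinearMap.smul_apply,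
    Q_apply (fun i => x i - x₀ i)]
  simp only [smul_eq_mul, ContinuousLinearMap.proj_apply, Pi.single_apply, Function.comp,
    eq_comm (a := j)]
  ring

lemma quad_form {n : ℕ} (d a : Fin n → ℝ) (r : ℝ) :
    ∑ i, ∑ j, ((if i = j then 1 else 0) * r - 2 * d i * d j * r ^ 2) * a i * a j
      = (∑ i, a i ^ 2) * r - 2 * (∑ i, d i * a i) ^ 2 * r ^ 2 := by
  have : ∀ i, ∑ j, ((if i = j then 1 else 0) * r - 2 * d i * d j * r ^ 2) * a i * a j
      = a i ^ 2 * r - (d i * a i) * (2 * r ^ 2 * ∑ j, d j * a j) := by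
    intro i
    have h : ∀ j, ((if i = j then 1 else 0) * r - 2 * d i * d j * r ^ 2) * a i * a j
      = (if i = j then a i * a j * r else 0) - (d i * a i * (2 * r ^ 2)) * (d j * a j) := by
      intro j
      split_ifs <;> ring
    simp only [h, Finset.sum_sub_distrib, ← Finset.mul_sum, Finset.sum_ite_eq,
      Finset.mem_univ, if_true]
    ring
  simp only [this, Finset.sum_sub_distrib, ← Finset.sum_mul]
  ring

/-- `φ(x) = log |x − x₀|` is a limiting Carleman weight away from `x₀`: its gradient never
vanishes, and `⟨φ''∇φ, ∇φ⟩ + ⟨φ''ξ, ξ⟩ = 0` whenever `|ξ| = |∇φ|` and `∇φ·ξ = 0`. -/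
theorem log_dist_is_limiting_Carleman_weight {n : ℕ} (hn : 2 ≤ n)
    (x₀ : Fin n → ℝ) (φ : (Fin n → ℝ) → ℝ)
    (hφ : ∀ x, φ x = Real.log (Real.sqrt (∑ i, (x i - x₀ i) ^ 2))) :
    ∀ x : Fin n → ℝ, x ≠ x₀ →
      ((fun i => pdR φ i x) ≠ 0
        ∧ ∀ ξ : Fin n → ℝ,
            Real.sqrt (∑ i, ξ i ^ 2) = Real.sqrt (∑ i, (pdR φ i x) ^ 2) →
            (∑ i, pdR φ i x * ξ i) = 0 →
            (∑ i, ∑ j, pdR (pdR φ j) i x * pdR φ i x * pdR φ j x)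
              + (∑ i, ∑ j, pdR (pdR φ j) i x * ξ i * ξ j) = 0) := by
  intro x hx
  have hQ := Q_pos x₀ x hx
  simp only [pdR_pdR_log x₀ φ hφ x hx]
  simp only [pdR_log x₀ φ hφ x hx]
  have hQd : ∑ i, (x i - x₀ i) ^ 2 = ∑ i, (x i - x₀ i) ^ 2 := rfl
  generalize hr : ∑ i, (x i - x₀ i) ^ 2 = Q at *
  refine ⟨?_, ?_⟩
  · intro h
    obtain ⟨i, hi⟩ := Function.ne_iff.mp hx
    have := congrFun h i
    simp only [Pi.zero_apply, mul_eq_zero, inv_eq_zero, sub_eq_zero] at this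
    exact this.elim hi hQ.ne'
  · intro ξ h1 h2
    rw [Real.sqrt_inj (Finset.sum_nonneg fun _ _ => sq_nonneg _)
      (Finset.sum_nonneg fun _ _ => sq_nonneg _)] at h1
    have g1 : ∑ i, ((x i - x₀ i) * Q⁻¹) ^ 2 = Q⁻¹ := by
      simp only [mul_pow, ← Finset.sum_mul, hr]
      field_simp
    have g2 : ∑ i, (x i - x₀ i) * ((x i - x₀ i) * Q⁻¹) = 1 := by
      simp only [← mul_assoc, ← pow_two, ← Finset.sum_mul, hr]
      field_simp
    have g3 : ∑ i, (x i - x₀ i) * ξ i = 0 := by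
      have : ∑ i, (x i - x₀ i) * Q⁻¹ * ξ i = (∑ i, (x i - x₀ i) * ξ i) * Q⁻¹ := by
        rw [Finset.sum_mul]
        exact Finset.sum_congr rfl fun _ _ => by ring
      rw [this] at h2
      exact (mul_eq_zero.mp h2).resolve_right (inv_ne_zero hQ.ne')
    rw [quad_form (fun i => x i - x₀ i) (fun i => (x i - x₀ i) * Q⁻¹) Q⁻¹,
      quad_form (fun i => x i - x₀ i) ξ Q⁻¹, h1, g1, g2, g3]
    ring
end

section
/- Let Ω be a set, M ≥ 0, K ≥ 0, ε ≥ 0. Let σ, σ̃ : Ω → ℂ be bounded with sup_Ω|σ| ≤ M, and let ψ₁, ψ₂, ψ̃₁, ψ̃₂ : Ω → ℂ be bounded with sup_Ω|ψ_j| ≤ K and sup_Ω|ψ̃_j| ≤ K for j = 1, 2, and sup_Ω|ψ_j − ψ̃_j| ≤ ε · sup_Ω|σ − σ̃| for j = 1, 2. Define 𝓗 := σ(ψ₁ + ψ₂ + ψ₁ψ₂) and 𝓗̃ := σ̃(ψ̃₁ + ψ̃₂ + ψ̃₁ψ̃₂). Then sup_Ω|𝓗 − 𝓗̃| ≤ (2Mε(1+K)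 + 2K + K²) · sup_Ω|σ − σ̃|. In particular, if 2Mε(1+K) + 2K + K² < 1, the map σ ↦ 𝓗 is a contraction with respect to the supremum norm. -/
open scoped BigOperators

theorem le_biSup_aux {α : Type*} (Ω : Set α) (f : α → ℝ) (C : ℝ) (h0 : ∀ x, 0 ≤ f x)
    (hC : ∀ x ∈ Ω, f x ≤ C) (x : α) (hx : x ∈ Ω) : f x ≤ ⨆ y ∈ Ω, f y := by
  have hb : BddAbove (Set.range fun y => ⨆ (_ : y ∈ Ω), f y) := by
    refine ⟨max C 0, ?_⟩
    rintro _ ⟨y, rfl⟩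
    exact Real.iSup_le (fun hy => (hC y hy).trans (le_max_left _ _)) (le_max_right _ _)
  have h := le_ciSup hb x
  simpa [hx] using h

/-- The algebraic contraction estimate for `𝓗[σ] = σ(ψ₁ + ψ₂ + ψ₁ψ₂)` in the sup norm:
`sup |𝓗 − 𝓗̃| ≤ (2Mε(1+K) + 2K + K²) sup |σ − σ̃|`. -/
theorem qtat_contraction_estimate {α : Type*} (Ω : Set α) (M K ε : ℝ)
    (hM : 0 ≤ M) (hK : 0 ≤ K) (hε : 0 ≤ ε)
    (σ σ' ψ₁ ψ₂ ψ₁' ψ₂' : α → ℂ)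
    (hσM : ∀ x ∈ Ω, ‖σ x‖ ≤ M) (hσ'bdd : ∃ M' : ℝ, ∀ x ∈ Ω, ‖σ' x‖ ≤ M')
    (hψ₁ : ∀ x ∈ Ω, ‖ψ₁ x‖ ≤ K) (hψ₂ : ∀ x ∈ Ω, ‖ψ₂ x‖ ≤ K)
    (hψ₁' : ∀ x ∈ Ω, ‖ψ₁' x‖ ≤ K) (hψ₂' : ∀ x ∈ Ω, ‖ψ₂' x‖ ≤ K)
    (hd₁ : (⨆ x ∈ Ω, ‖ψ₁ x - ψ₁' x‖) ≤ ε * ⨆ x ∈ Ω, ‖σ x - σ' x‖)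
    (hd₂ : (⨆ x ∈ Ω, ‖ψ₂ x - ψ₂' x‖) ≤ ε * ⨆ x ∈ Ω, ‖σ x - σ' x‖) :
    (⨆ x ∈ Ω,
        ‖σ x * (ψ₁ x + ψ₂ x + ψ₁ x * ψ₂ x)
          - σ' x * (ψ₁' x + ψ₂' x + ψ₁' x * ψ₂' x)‖)
      ≤ (2 * M * ε * (1 + K) + 2 * K + K ^ 2) * ⨆ x ∈ Ω, ‖σ x - σ' x‖ := by
  have hS0 : 0 ≤ ⨆ x ∈ Ω, ‖σ x - σ' x‖ :=
    Real.iSup_nonneg fun x => Real.iSup_nonneg fun _ => norm_nonneg _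
  obtain ⟨M', hM'⟩ := hσ'bdd
  have a0 := le_biSup_aux Ω (fun x => ‖σ x - σ' x‖) (M + M') (fun _ => norm_nonneg _)
    (fun x hx => (norm_sub_le _ _).trans (add_le_add (hσM x hx) (hM' x hx)))
  have a1 := le_biSup_aux Ω (fun x => ‖ψ₁ x - ψ₁' x‖) (K + K) (fun _ => norm_nonneg _)
    (fun x hx => (norm_sub_le _ _).trans (add_le_add (hψ₁ x hx) (hψ₁' x hx)))
  have a2 := le_biSup_aux Ω (fun x => ‖ψ₂ x - ψ₂' x‖) (K + K) (fun _ => norm_nonneg _)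
    (fun x hx => (norm_sub_le _ _).trans (add_le_add (hψ₂ x hx) (hψ₂' x hx)))
  generalize (⨆ x ∈ Ω, ‖σ x - σ' x‖) = S at *
  have hR : 0 ≤ (2 * M * ε * (1 + K) + 2 * K + K ^ 2) * S := by positivity
  refine Real.iSup_le (fun x => Real.iSup_le (fun hx => ?_) hR) hR
  have b0 : ‖σ x - σ' x‖ ≤ S := a0 x hx
  have b1 : ‖ψ₁ x - ψ₁' x‖ ≤ ε * S := (a1 x hx).trans hd₁
  have b2 : ‖ψ₂ x - ψ₂' x‖ ≤ ε * S := (a2 x hx).trans hd₂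
  have c1 := hψ₁' x hx
  have c2 := hψ₂' x hx
  have c3 := hψ₂ x hx
  have c4 := hσM x hx
  have e : σ x * (ψ₁ x + ψ₂ x + ψ₁ x * ψ₂ x) - σ' x * (ψ₁' x + ψ₂' x + ψ₁' x * ψ₂' x)
      = σ x * ((ψ₁ x - ψ₁' x) + (ψ₂ x - ψ₂' x)
          + ((ψ₁ x - ψ₁' x) * ψ₂ x + ψ₁' x * (ψ₂ x - ψ₂' x)))
        + (σ x - σ' x) * (ψ₁' x + ψ₂' x + ψ₁' x * ψ₂' x) := by ring
  rw [e]
  calc _ ≤ ‖σ x‖ * ((‖ψ₁ x - ψ₁' x‖ + ‖ψ₂ x - ψ₂' x‖)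
          + (‖ψ₁ x - ψ₁' x‖ * ‖ψ₂ x‖ + ‖ψ₁' x‖ * ‖ψ₂ x - ψ₂' x‖))
        + ‖σ x - σ' x‖ * ((‖ψ₁' x‖ + ‖ψ₂' x‖) + ‖ψ₁' x‖ * ‖ψ₂' x‖) := by
        refine (norm_add_le _ _).trans ?_
        rw [norm_mul, norm_mul]
        gcongr
        · refine (norm_add_le _ _).trans (add_le_add (norm_add_le _ _) ?_)
          refine (norm_add_le _ _).trans ?_
          rw [norm_mul, norm_mul]
        · refine (norm_add_le _ _).trans (add_le_add (norm_add_le _ _) ?_)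
          rw [norm_mul]
    _ ≤ M * ((ε * S + ε * S) + (ε * S * K + K * (ε * S))) + S * ((K + K) + K * K) := by
        gcongr
    _ = _ := by ring
end

section
/- Let k > 0, σ₀ > 0, n₀ > 0 be real numbers and set q₀ := k²n₀ + ikσ₀ (so |q₀|² = k⁴n₀² + k²σ₀² > 0). Let J ≥ 2, let E₁, …, E_J ∈ ℂ³ be nonzero vectors, and let ξ ∈ ℝ³ with ξ ≠ 0. For each j define a_j := −|E_j|²|ξ|² + (2k²σ₀²/|q₀|²)|E_j·ξ|² and b_j := (2k⁴σ₀n₀/|q₀|²)|E_j·ξ|², where E·ξ = ∑ᵢ Eᵢξᵢ. Then the J×2 real matrix whose j-th row is (a_j, b_j) has rank 2 if and only if there exist indices j ≠ l with |Ê_j·ξ| ≠ |Ê_l·ξ|, where Ê_j := E_j/|E_j|. -/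
open scoped BigOperators

theorem qtat_rank_two_aux {J : ℕ} (a b : Fin J → ℝ) :
    (Matrix.of fun j : Fin J => ![a j, b j]).rank = 2 ↔
      ∀ s t : ℝ, (∀ j, s * a j + t * b j = 0) → s = 0 ∧ t = 0 := by
  rw [Matrix.rank_eq_finrank_span_cols]
  have h := linearIndependent_iff_card_eq_finrank_span (R := ℝ)
    (b := (Matrix.of fun j : Fin J => ![a j, b j]).col)
  rw [Set.finrank, Fintype.card_fin, eq_comm] at h
  rw [← h, Fintype.linearIndependent_iff]
  constructor
  · intro H s t hst
    have := H ![s, t] (by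
      ext j
      simpa [Fin.sum_univ_two, Matrix.col] using hst j)
    exact ⟨by simpa using this 0, by simpa using this 1⟩
  · intro H g hg
    have := H (g 0) (g 1) (fun j => by
      have := congrFun hg j
      simpa [Fin.sum_univ_two, Matrix.col] using this)
    intro i
    fin_cases i
    · exact this.1
    · exact this.2

/-- Ellipticity criterion for the linearized QTAT Maxwell problem: the `J×2` symbol matrix
with rows `(a_j, b_j)` has rank 2 iff at least two of the values `|Ê_j·ξ|` differ. -/
theorem qtat_symbol_rank_two_iff (k σ₀ n₀ : ℝ) (hk : 0 < k) (hσ₀ : 0 < σ₀) (hn₀ : 0 < n₀)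
    (q₀ : ℂ) (hq₀ : q₀ = (k : ℂ) ^ 2 * (n₀ : ℂ) + Complex.I * (k : ℂ) * (σ₀ : ℂ))
    (J : ℕ) (hJ : 2 ≤ J)
    (E : Fin J → Fin 3 → ℂ) (hE : ∀ j, E j ≠ 0)
    (ξ : Fin 3 → ℝ) (hξ : ξ ≠ 0)
    (a b : Fin J → ℝ)
    (ha : ∀ j, a j = -(∑ i, ‖E j i‖ ^ 2) * (∑ i, ξ i ^ 2)
        + (2 * k ^ 2 * σ₀ ^ 2 / ‖q₀‖ ^ 2) * ‖∑ i, E j i * (ξ i : ℂ)‖ ^ 2)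
    (hb : ∀ j, b j = (2 * k ^ 4 * σ₀ * n₀ / ‖q₀‖ ^ 2) * ‖∑ i, E j i * (ξ i : ℂ)‖ ^ 2) :
    (Matrix.of fun j : Fin J => ![a j, b j]).rank = 2 ↔
      ∃ j l : Fin J, j ≠ l ∧
        ‖∑ i, E j i / ((Real.sqrt (∑ i, ‖E j i‖ ^ 2) : ℝ) : ℂ) * (ξ i : ℂ)‖
          ≠ ‖∑ i, E l i / ((Real.sqrt (∑ i, ‖E l i‖ ^ 2) : ℝ) : ℂ) * (ξ i : ℂ)‖ := by
  rw [qtat_rank_two_aux]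
  have hN : ∀ j, 0 < ∑ i, ‖E j i‖ ^ 2 := by
    intro j
    obtain ⟨i, hi⟩ := Function.ne_iff.mp (hE j)
    exact Finset.sum_pos' (fun i _ => by positivity)
      ⟨i, Finset.mem_univ _, pow_pos (norm_pos_iff.mpr hi) 2⟩
  have hX : 0 < ∑ i, ξ i ^ 2 := by
    obtain ⟨i, hi⟩ := Function.ne_iff.mp hξ
    exact Finset.sum_pos' (fun i _ => by positivity)
      ⟨i, Finset.mem_univ _, by have : ξ i ≠ 0 := hi; positivity⟩
  have hq : q₀ ≠ 0 := by
    intro h0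
    have := congrArg Complex.im (hq₀.symm.trans h0)
    simp [← Complex.ofReal_pow] at this
    rcases this with h | h <;> linarith
  have hd : 0 < 2 * k ^ 4 * σ₀ * n₀ / ‖q₀‖ ^ 2 := by
    have := norm_pos_iff.mpr hq
    positivity
  have hr : ∀ j, ‖∑ i, E j i * (ξ i : ℂ)‖ ^ 2 =
      ‖∑ i, E j i / ((Real.sqrt (∑ i, ‖E j i‖ ^ 2) : ℝ) : ℂ) * (ξ i : ℂ)‖ ^ 2
        * ∑ i, ‖E j i‖ ^ 2 := by
    intro j
    have h1 : ∑ i, E j i / ((Real.sqrt (∑ i, ‖E j i‖ ^ 2) : ℝ) : ℂ) * (ξ i : ℂ)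
        = (∑ i, E j i * (ξ i : ℂ)) / ((Real.sqrt (∑ i, ‖E j i‖ ^ 2) : ℝ) : ℂ) := by
      rw [Finset.sum_div]
      exact Finset.sum_congr rfl fun i _ => by ring
    rw [h1, norm_div, Complex.norm_real, div_pow, Real.norm_eq_abs, sq_abs,
      Real.sq_sqrt (hN j).le, div_mul_cancel₀ _ (hN j).ne']
  have hnn : ∀ j, 0 ≤ ‖∑ i, E j i / ((Real.sqrt (∑ i, ‖E j i‖ ^ 2) : ℝ) : ℂ) * (ξ i : ℂ)‖ :=
    fun j => norm_nonneg _
  simp only [hr] at ha hb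
  generalize hrj : (fun j => ‖∑ i, E j i / ((Real.sqrt (∑ i, ‖E j i‖ ^ 2) : ℝ) : ℂ) * (ξ i : ℂ)‖)
    = r at *
  have hrj' := fun j => congrFun hrj j
  simp only [hrj'] at ha hb hnn ⊢
  generalize 2 * k ^ 4 * σ₀ * n₀ / ‖q₀‖ ^ 2 = d at *
  generalize 2 * k ^ 2 * σ₀ ^ 2 / ‖q₀‖ ^ 2 = c at *
  generalize (∑ i, ξ i ^ 2) = X at *
  constructor
  · intro H
    by_contra hcon
    push Not at hcon
    let z : Fin J := ⟨0, by omega⟩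
    have hz : ∀ j, r j = r z := fun j => by
      by_cases hj : j = z
      · rw [hj]
      · exact hcon j z hj
    obtain ⟨h1, h2⟩ := H (d * r z ^ 2) (X - c * r z ^ 2) (fun j => by
      rw [ha, hb, hz j]; ring)
    have h3 : r z ^ 2 = 0 := (mul_eq_zero.mp h1).resolve_left hd.ne'
    rw [h3] at h2
    linarith
  · rintro ⟨j, l, -, hne⟩ s t hst
    have key : ∀ j, (s * c + t * d) * r j ^ 2 = s * X := fun j => by
      have h := hst j
      rw [ha, hb] at h
      apply mul_right_cancel₀ (hN j).ne'
      linear_combination h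
    have h0 : s * c + t * d = 0 := by
      by_contra h
      have h2 := mul_left_cancel₀ h ((key j).trans (key l).symm)
      exact hne ((sq_eq_sq₀ (hnn j) (hnn l)).mp h2)
    have hs : s = 0 := by
      have := key j
      rw [h0, zero_mul] at this
      exact (mul_eq_zero.mp this.symm).resolve_right hX.ne'
    refine ⟨hs, ?_⟩
    rw [hs, zero_mul, zero_add] at h0
    exact (mul_eq_zero.mp h0).resolve_right hd.ne'
end

section
/- There exist four pairs (ρ₁, ρ₁⊥), (ρ₂, ρ₂⊥), (ρ₃, ρ₃⊥), (ρ₄, ρ₄⊥) of orthonormal vectors in ℝ³ such that for every ξ ∈ ℝ³ with ξ ≠ 0, the four real numbers |ξ·ρ_j|² + |ξ·ρ_j⊥|², j = 1, 2, 3, 4, are not all equal (i.e., at least two of them differ). -/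
open scoped BigOperators

/-- Geometric selection lemma: there are four orthonormal pairs `(ρ_j, ρ_j⊥)` in `ℝ³` so that
for every nonzero frequency `ξ`, the four numbers `|ξ·ρ_j|² + |ξ·ρ_j⊥|²` are not all equal. -/
theorem four_orthonormal_pairs_separating :
    ∃ ρ ρp : Fin 4 → Fin 3 → ℝ,
      (∀ j, ∑ i, ρ j i ^ 2 = 1) ∧ (∀ j, ∑ i, ρp j i ^ 2 = 1)
        ∧ (∀ j, ∑ i, ρ j i * ρp j i = 0)
        ∧ ∀ ξ : Fin 3 → ℝ, ξ ≠ 0 →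
            ∃ j l : Fin 4,
              (∑ i, ξ i * ρ j i) ^ 2 + (∑ i, ξ i * ρp j i) ^ 2
                ≠ (∑ i, ξ i * ρ l i) ^ 2 + (∑ i, ξ i * ρp l i) ^ 2 := by
  refine ⟨![![0,1,0], ![1,0,0], ![1,0,0], ![4/5,-3/5,0]],
    ![![0,0,1], ![0,0,1], ![0,1,0], ![0,0,1]], ?_, ?_, ?_, ?_⟩
  · intro j
    fin_cases j <;> simp [Fin.sum_univ_three] <;> norm_num
  · intro j
    fin_cases j <;> simp [Fin.sum_univ_three] <;> norm_num
  · intro j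
    fin_cases j <;> simp [Fin.sum_univ_three] <;> norm_num
  · intro ξ hξ
    by_contra hcon
    push Not at hcon
    apply hξ
    have h1 := hcon 0 1
    have h2 := hcon 0 2
    have h3 := hcon 0 3
    simp [Fin.sum_univ_three] at h1 h2 h3
    have hx : ξ 0 ^ 2 = ξ 1 ^ 2 := by linarith
    have hz : ξ 2 ^ 2 = ξ 0 ^ 2 := by linarith
    have hxy : ξ 0 * ξ 1 = 0 := by nlinarith
    have h0 : ξ 0 = 0 := by
      rcases mul_eq_zero.mp hxy with h | h
      · exact h
      · rw [h] at hx
        simpa using hx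
    have h1' : ξ 1 = 0 := by
      rw [h0] at hx
      simpa using hx.symm
    have h2' : ξ 2 = 0 := by
      rw [h0] at hz
      simpa using hz
    funext i
    fin_cases i
    · exact h0
    · exact h1'
    · exact h2'
end
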